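/- Let α be irrational with |α − a/q| < 1/q², (a,q) = 1, q ≥ 1. Let M, S, J, x be positive reals with x > M³S²J, and let μ, σ, ζ be integers ≥ 2. Define G = Σ_{m ∼ M} τ_μ(m) Σ_{s ∼ S} τ_σ(s) Σ_{j ∼ J} τ_ζ(j) min{ x/(m³s²j), 1/‖α m³ s² j‖ }. Then for any ε > 0, G ≪ x^ε ( MSJ + x/(M^{9/4} S) + x/(M² S^{9/8}) + x/(M² S q^{1/8}) + x^{7/8} q^{1/8}/(M² S) ). -/

import Mathlib

noncomputable section

/-- `e y = exp(2πiy)`. -/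
def e (y : ℝ) : ℂ := Complex.exp (2 * Real.pi * Complex.I * y)

/-- Distance from `y` to the nearest integer. -/
def nint (y : ℝ) : ℝ := |y - round y|

/-- The set of naturals `n` with `X/2 ≤ n < X` (written `n ∼ X`). -/
def dyad (X : ℝ) : Finset ℕ := Finset.Ico ⌈X / 2⌉₊ ⌈X⌉₊

/-- `d` is a well-separable number of level `D`. -/
def WellSeparable (D : ℝ) (d : ℕ) : Prop :=
  ∀ H S : ℝ, 1 ≤ H → 1 ≤ S → H * S = D →
    ∃ h s : ℕ, (h : ℝ) ≤ H ∧ (s : ℝ) ≤ S ∧ d = h * s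

/-- `K = x^θ (log x)²`. -/
def Kf (θ x : ℝ) : ℝ := x ^ θ * (Real.log x) ^ 2

/-- `Δ = x^ρ`. -/
def Δf (ρ x : ℝ) : ℝ := x ^ ρ

/-- `D = x^{1/2} / (Δ K⁴)`. -/
def Df (θ ρ x : ℝ) : ℝ := x ^ ((1 : ℝ) / 2) / (Δf ρ x * (Kf θ x) ^ 4)

/-- The exponential sum `W(x)`. -/
def Wsum (α β : ℝ) (b : ℤ) (D K x : ℝ) (lam : ℕ → ℂ) (c : ℤ → ℂ) : ℂ :=
  ∑ d ∈ Finset.Icc 1 ⌊D⌋₊, lam d *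
    ∑ k ∈ (Finset.Icc (-(⌊K⌋₊ : ℤ)) (⌊K⌋₊ : ℤ)).filter (fun k => k ≠ 0), c k *
      ∑ n ∈ dyad x,
        if (n : ℤ) % (d : ℤ) = b % (d : ℤ) then
          (ArithmeticFunction.vonMangoldt n : ℂ) *
            e ((α * (n : ℝ) ^ 2 + β) * (k : ℝ))
        else 0

/-- `τ_k(n)`: the number of ordered representations of `n` as a product of `k`
positive integers. -/
def tauk (k n : ℕ) : ℕ :=
  ((Fintype.piFinset fun _ : Fin k => Finset.Icc 1 n).filter
    (fun t => ∏ i, t i = n)).card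

/-- The sum `G` of Lemma 7. -/
def Gsum (α x M S J : ℝ) (μ σ ζ : ℕ) : ℝ :=
  ∑ m ∈ dyad M, (tauk μ m : ℝ) *
    ∑ s ∈ dyad S, (tauk σ s : ℝ) *
      ∑ j ∈ dyad J, (tauk ζ j : ℝ) *
        min (x / ((m : ℝ) ^ 3 * (s : ℝ) ^ 2 * (j : ℝ)))
          (1 / nint (α * ((m : ℝ) ^ 3 * (s : ℝ) ^ 2 * (j : ℝ))))



lemma nint_nonneg (y : ℝ) : 0 ≤ nint y := abs_nonneg _

lemma nint_le (y : ℝ) (z : ℤ) : nint y ≤ |y - z| := round_le y z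

lemma nint_le_half (y : ℝ) : nint y ≤ 1 / 2 := abs_sub_round y

/-- `mn B y = min(B, 1/‖y‖)`, without junk values. -/
def mn (B y : ℝ) : ℝ := B / max 1 (B * nint y)

lemma mn_nonneg {B : ℝ} (hB : 0 ≤ B) (y : ℝ) : 0 ≤ mn B y := by
  unfold mn; positivity

lemma mn_le {B : ℝ} (hB : 0 ≤ B) (y : ℝ) : mn B y ≤ B := by
  unfold mn; exact div_le_self hB (le_max_left _ _)

lemma mn_mul_nint_le (B y : ℝ) : mn B y * nint y ≤ 1 := by
  unfold mn
  rw [div_mul_eq_mul_div, div_le_one (by positivity)]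
  exact le_max_right _ _

lemma le_mn {B y t : ℝ} (hB : 0 ≤ B) (_h0 : 0 ≤ t) (h1 : t ≤ B) (h2 : t * nint y ≤ 1) :
    t ≤ mn B y := by
  unfold mn
  rw [le_div_iff₀ (by positivity)]
  rcases le_total 1 (B * nint y) with h | h
  · rw [max_eq_right h]; nlinarith
  · rw [max_eq_left h]; linarith

lemma mn_mono {B B' : ℝ} (hB : 0 ≤ B) (h : B ≤ B') (y : ℝ) : mn B y ≤ mn B' y :=
  le_mn (hB.trans h) (mn_nonneg hB y) ((mn_le hB y).trans h) (mn_mul_nint_le B y)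

lemma min_le_mn {A B : ℝ} (hA : 0 ≤ A) (hAB : A ≤ B) (y : ℝ) : min A (1 / nint y) ≤ mn B y := by
  have hn := nint_nonneg y
  apply le_mn (hA.trans hAB) (le_min hA (by positivity)) ((min_le_left _ _).trans hAB)
  calc min A (1 / nint y) * nint y ≤ (1 / nint y) * nint y :=
        mul_le_mul_of_nonneg_right (min_le_right _ _) hn
    _ ≤ 1 := by rw [one_div]; exact inv_mul_le_one

lemma e_eq (y : ℝ) : e y = Complex.exp (Complex.I * ((2 * Real.pi * y : ℝ) : ℂ)) := by
  unfold e; congr 1; push_cast; ring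

lemma e_add (x y : ℝ) : e (x + y) = e x * e y := by
  unfold e; rw [← Complex.exp_add]; congr 1; push_cast; ring

lemma e_norm (y : ℝ) : ‖e y‖ = 1 := by
  rw [e_eq, mul_comm, Complex.norm_exp_ofReal_mul_I]

lemma e_zero : e 0 = 1 := by simp [e]

lemma e_int (n : ℤ) : e n = 1 := by
  unfold e
  rw [Complex.exp_eq_one_iff]
  exact ⟨n, by push_cast; ring⟩

lemma e_conj (y : ℝ) : (starRingEnd ℂ) (e y) = e (-y) := by
  unfold e
  rw [← Complex.exp_conj]; congr 1
  simp
  left; exact map_ofNat _ 2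

lemma e_re (y : ℝ) : (e y).re = Real.cos (2 * Real.pi * y) := by
  rw [e_eq, mul_comm, Complex.exp_ofReal_mul_I_re]

lemma e_nat_mul (n : ℕ) (y : ℝ) : e (n * y) = e y ^ n := by
  unfold e; rw [← Complex.exp_nat_mul]; congr 1; push_cast; ring

lemma e_sub_round (y : ℝ) : e (y - round y) = e y := by
  have := e_add (y - round y) (round y)
  rw [e_int] at this
  simpa using this.symm

lemma two_nint_le (y : ℝ) : 2 * nint y ≤ ‖e y - 1‖ := by
  rw [← e_sub_round, e_eq, Complex.norm_exp_I_mul_ofReal_sub_one, Real.norm_eq_abs, abs_mul]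
  have h : |2 * Real.pi * (y - round y) / 2| ≤ Real.pi / 2 := by
    have := abs_sub_round y
    rw [show 2 * Real.pi * (y - round y) / 2 = Real.pi * (y - round y) by ring, abs_mul,
      abs_of_pos Real.pi_pos]
    nlinarith [Real.pi_pos]
  have h2 := Real.mul_abs_le_abs_sin h
  have h3 : 2 / Real.pi * |2 * Real.pi * (y - round y) / 2| = 2 * nint y := by
    rw [show 2 * Real.pi * (y - round y) / 2 = Real.pi * (y - round y) by ring, abs_mul,
      abs_of_pos Real.pi_pos]
    unfold nint
    field_simp [Real.pi_pos.ne']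
  rw [h3] at h2
  have := nint_nonneg y
  simp only [abs_two]
  linarith

lemma geom_bound (N : ℕ) (b c : ℝ) :
    ‖∑ n ∈ Finset.range N, e (b * n + c)‖ ≤ mn N b := by
  have h1 : ∑ n ∈ Finset.range N, e (b * n + c) = (∑ n ∈ Finset.range N, e b ^ n) * e c := by
    rw [Finset.sum_mul]
    refine Finset.sum_congr rfl fun n _ => ?_
    rw [e_add, mul_comm b, e_nat_mul]
  rw [h1, norm_mul, e_norm, mul_one]
  apply le_mn (by positivity) (norm_nonneg _)
  · refine (norm_sum_le _ _).trans ?_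
    simp [e_norm]
  · have h2 : (∑ n ∈ Finset.range N, e b ^ n) * (e b - 1) = e b ^ N - 1 := geom_sum_mul _ _
    have h3 : ‖e b ^ N - 1‖ ≤ 2 := by
      refine (norm_sub_le _ _).trans ?_
      simp [e_norm]; norm_num
    rw [← h2, norm_mul] at h3
    have := two_nint_le b
    have h4 := norm_nonneg (∑ n ∈ Finset.range N, e b ^ n)
    nlinarith

/-- Reindexing pairs by their difference. -/
lemma sum_pairs {R : Type*} [AddCommMonoid R] (N : ℕ) (F : ℕ → ℕ → R) :
    ∑ k ∈ Finset.range N, ∑ n ∈ Finset.range k, F k n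
      = ∑ h ∈ Finset.Ico 1 N, ∑ n ∈ Finset.range (N - h), F (n + h) n := by
  rw [Finset.sum_sigma', Finset.sum_sigma']
  refine Finset.sum_bij' (fun p _ => ⟨p.1 - p.2, p.2⟩) (fun p _ => ⟨p.2 + p.1, p.2⟩) ?_ ?_ ?_ ?_ ?_
  · rintro ⟨k, n⟩ h; simp at h ⊢; omega
  · rintro ⟨k, n⟩ h; simp at h ⊢; omega
  · rintro ⟨k, n⟩ h; simp at h ⊢; omega
  · rintro ⟨k, n⟩ h; simp at h ⊢
  · rintro ⟨k, n⟩ h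
    simp at h ⊢
    rw [Nat.add_sub_cancel' h.2.le]

lemma norm_sq_sum (z : ℕ → ℂ) (N : ℕ) :
    ‖∑ n ∈ Finset.range N, z n‖ ^ 2 = ∑ n ∈ Finset.range N, ‖z n‖ ^ 2
      + 2 * (∑ k ∈ Finset.range N, ∑ n ∈ Finset.range k, z k * (starRingEnd ℂ) (z n)).re := by
  induction N with
  | zero => simp
  | succ N ih =>
    rw [Finset.sum_range_succ, Finset.sum_range_succ, Finset.sum_range_succ, Complex.add_re,
      ← Complex.normSq_eq_norm_sq, Complex.normSq_add, Complex.normSq_eq_norm_sq, ih,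
      Complex.normSq_eq_norm_sq, ← Finset.mul_sum, ← map_sum]
    have : (∑ n ∈ Finset.range N, z n) * (starRingEnd ℂ) (z N)
       = (starRingEnd ℂ) (z N * (starRingEnd ℂ) (∑ n ∈ Finset.range N, z n)) := by
      simp [mul_comm]
    rw [this, Complex.conj_re]
    ring

lemma weyl_sq (z : ℕ → ℂ) (N : ℕ) :
    ‖∑ n ∈ Finset.range N, z n‖ ^ 2 ≤ ∑ n ∈ Finset.range N, ‖z n‖ ^ 2
      + 2 * ∑ h ∈ Finset.Ico 1 N,
        ‖∑ n ∈ Finset.range (N - h), z (n + h) * (starRingEnd ℂ) (z n)‖ := by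
  rw [norm_sq_sum, sum_pairs N (fun k n => z k * (starRingEnd ℂ) (z n))]
  gcongr
  exact (Complex.re_le_norm _).trans (norm_sum_le _ _)

lemma weyl_quad (N A : ℕ) (hNA : N ≤ A) (a b c : ℝ) :
    ‖∑ n ∈ Finset.range N, e (a * n ^ 2 + b * n + c)‖ ^ 2
      ≤ A + 2 * ∑ h ∈ Finset.Ico 1 A, mn A (2 * a * h) := by
  refine (weyl_sq _ N).trans ?_
  have h0 : (N : ℝ) ≤ A := by exact_mod_cast hNA
  gcongr ?_ + 2 * ?_
  · simp [e_norm, h0]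
  · calc _ ≤ ∑ h ∈ Finset.Ico 1 N, mn A (2 * a * h) := by
          refine Finset.sum_le_sum fun h hh => ?_
          have : ∀ n ∈ Finset.range (N - h),
              e (a * (n + h : ℕ) ^ 2 + b * (n + h : ℕ) + c) *
                (starRingEnd ℂ) (e (a * n ^ 2 + b * n + c))
              = e ((2 * a * h) * n + (a * h ^ 2 + b * h)) := by
            intro n _
            rw [e_conj, ← e_add]; congr 1; push_cast; ring
          rw [Finset.sum_congr rfl this]
          refine (geom_bound _ _ _).trans (mn_mono (by positivity) ?_ _)
          exact (by exact_mod_cast Nat.sub_le N h : ((N - h : ℕ) : ℝ) ≤ N).trans h0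
      _ ≤ _ := by
          refine Finset.sum_le_sum_of_subset_of_nonneg (Finset.Ico_subset_Ico_right hNA) ?_
          intro i _ _; exact mn_nonneg (by positivity) _

lemma weyl_cubic (N A : ℕ) (hNA : N ≤ A) (b : ℝ) (m0 : ℕ) :
    ‖∑ n ∈ Finset.range N, e (b * (m0 + n : ℕ) ^ 3)‖ ^ 4
      ≤ 10 * (A : ℝ) ^ 3 + 16 * A * ∑ h₁ ∈ Finset.Ico 1 A, ∑ h₂ ∈ Finset.Ico 1 A,
        mn A (b * (6 * (h₁ * h₂) : ℕ)) := by
  have h0 : (N : ℝ) ≤ A := by exact_mod_cast hNA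
  rcases Nat.eq_zero_or_pos A with hA | hA
  · have : N = 0 := by omega
    subst this hA; simp
  have hA1 : (1 : ℝ) ≤ A := by exact_mod_cast hA
  have h1 := weyl_sq (fun n => e (b * (m0 + n : ℕ) ^ 3)) N
  set X := ‖∑ n ∈ Finset.range N, e (b * (m0 + n : ℕ) ^ 3)‖ with hX
  set Y : ℕ → ℝ := fun h => ‖∑ n ∈ Finset.range (N - h), e (b * (m0 + (n + h) : ℕ) ^ 3)
    * (starRingEnd ℂ) (e (b * (m0 + n : ℕ) ^ 3))‖ with hY
  have h2 : X ^ 2 ≤ A + 2 * ∑ h ∈ Finset.Ico 1 N, Y h := by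
    refine h1.trans ?_
    gcongr ?_ + ?_
    · simp [e_norm, h0]
    · exact le_refl _
  have h3 : ∀ h ∈ Finset.Ico 1 N, Y h ^ 2 ≤ A + 2 * ∑ h₂ ∈ Finset.Ico 1 A,
        mn A (b * (6 * (h * h₂) : ℕ)) := by
    intro h _
    have : ∀ n ∈ Finset.range (N - h), e (b * (m0 + (n + h) : ℕ) ^ 3)
        * (starRingEnd ℂ) (e (b * (m0 + n : ℕ) ^ 3))
        = e ((3 * h * b) * n ^ 2 + (3 * b * (2 * m0 * h + h ^ 2)) * n
          + b * (3 * m0 ^ 2 * h + 3 * m0 * h ^ 2 + h ^ 3)) := by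
      intro n _
      rw [e_conj, ← e_add]; congr 1; push_cast; ring
    simp only [hY]
    rw [Finset.sum_congr rfl this]
    refine (weyl_quad _ A ((Nat.sub_le N h).trans hNA) _ _ _).trans (le_of_eq ?_)
    congr 2
    refine Finset.sum_congr rfl fun k _ => ?_
    congr 1; push_cast; ring
  have h4 : (∑ h ∈ Finset.Ico 1 N, Y h) ^ 2 ≤ A * ∑ h ∈ Finset.Ico 1 A, (A + 2 *
      ∑ h₂ ∈ Finset.Ico 1 A, mn A (b * (6 * (h * h₂) : ℕ))) := by
    refine (sq_sum_le_card_mul_sum_sq).trans ?_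
    have hc : ((Finset.Ico 1 N).card : ℝ) ≤ A := by
      rw [Nat.card_Ico]; exact_mod_cast (by omega : N - 1 ≤ A)
    refine mul_le_mul hc ?_ (Finset.sum_nonneg fun i _ => sq_nonneg _) (by positivity)
    refine (Finset.sum_le_sum h3).trans ?_
    refine Finset.sum_le_sum_of_subset_of_nonneg (Finset.Ico_subset_Ico_right hNA) ?_
    intro i _ _
    have : 0 ≤ ∑ h₂ ∈ Finset.Ico 1 A, mn A (b * (6 * (i * h₂) : ℕ)) :=
      Finset.sum_nonneg fun i _ => mn_nonneg (by positivity) _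
    positivity
  rw [Finset.sum_add_distrib, ← Finset.mul_sum] at h4
  set Q := ∑ h₁ ∈ Finset.Ico 1 A, ∑ h₂ ∈ Finset.Ico 1 A, mn A (b * (6 * (h₁ * h₂) : ℕ)) with hQ
  have h5 : ∑ h ∈ Finset.Ico 1 A, (A : ℝ) ≤ A ^ 2 := by
    simp only [Finset.sum_const, Nat.card_Ico, nsmul_eq_mul]
    have : ((A - 1 : ℕ) : ℝ) ≤ A := by exact_mod_cast Nat.sub_le _ _
    nlinarith
  set T := ∑ h ∈ Finset.Ico 1 N, Y h with hT
  have hX2 : 0 ≤ X ^ 2 := sq_nonneg _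
  have h6 : X ^ 4 ≤ 2 * A ^ 2 + 8 * T ^ 2 := by
    have : X ^ 4 ≤ (A + 2 * T) ^ 2 := by
      rw [show X ^ 4 = (X ^ 2) ^ 2 by ring]; gcongr
    nlinarith [sq_nonneg ((A : ℝ) - 2 * T)]
  have h7 : A * (∑ h ∈ Finset.Ico 1 A, (A : ℝ) + 2 * Q) ≤ A * (A ^ 2 + 2 * Q) := by gcongr
  nlinarith [mul_le_mul_of_nonneg_left hA1 (sq_nonneg (A : ℝ))]


lemma fejer_term {y : ℝ} {L : ℕ} (hL : 1 ≤ L) (h : 8 * (L : ℝ) * nint y ≤ 1) :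
    (1 : ℝ) / 4 ≤ ‖∑ l ∈ Finset.range L, e (l * y)‖ ^ 2 / (L : ℝ) ^ 2 := by
  have hL' : (1 : ℝ) ≤ L := by exact_mod_cast hL
  rw [le_div_iff₀ (by positivity)]
  have h1 : (L : ℝ) / 2 ≤ ‖∑ l ∈ Finset.range L, e (l * y)‖ := by
    refine le_trans ?_ (Complex.re_le_norm _)
    rw [Complex.re_sum]
    have : ∀ l ∈ Finset.range L, (1 : ℝ) / 2 ≤ (e (l * y)).re := by
      intro l hl
      have hl' : (l : ℝ) ≤ L := by exact_mod_cast (Finset.mem_range.1 hl).le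
      rw [e_nat_mul, ← e_sub_round, ← e_nat_mul, e_re]
      refine le_trans ?_ Real.one_sub_sq_div_two_le_cos
      set t := y - round y with ht
      have h2 : |l * t| ≤ 1 / 8 := by
        rw [abs_mul, Nat.abs_cast]
        have : nint y = |t| := rfl
        rw [this] at h
        nlinarith [abs_nonneg t]
      have h3 : (l * t) ^ 2 ≤ (1 / 8) ^ 2 := sq_le_sq' (abs_le.1 h2).1 (abs_le.1 h2).2
      have h4 : (2 * Real.pi * (l * t)) ^ 2 = 4 * Real.pi ^ 2 * (l * t) ^ 2 := by ring
      rw [h4]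
      have h5 : Real.pi ^ 2 ≤ 16 := by nlinarith [Real.pi_pos, Real.pi_le_four]
      nlinarith [sq_nonneg (l * t)]
    calc (L : ℝ) / 2 = ∑ l ∈ Finset.range L, (1 : ℝ) / 2 := by simp; ring
      _ ≤ _ := Finset.sum_le_sum this
  nlinarith

lemma fejer_lower (B : ℕ) (hB : 1 ≤ B) (y : ℝ) :
    mn B y ≤ 64 * ∑ L ∈ Finset.Icc 1 B, ‖∑ l ∈ Finset.range L, e (l * y)‖ ^ 2 / (L : ℝ) ^ 2 := by
  set F : ℕ → ℝ := fun L => ‖∑ l ∈ Finset.range L, e (l * y)‖ ^ 2 / (L : ℝ) ^ 2 with hF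
  have hF0 : ∀ L, 0 ≤ F L := fun L => by simp only [hF]; positivity
  have h1 : 1 ≤ ∑ L ∈ Finset.Icc 1 B, F L := by
    have : F 1 = 1 := by simp [hF, e_norm]
    rw [← this]
    exact Finset.single_le_sum (fun i _ => hF0 i) (by simp [hB])
  by_cases hm : mn B y ≤ 64
  · linarith
  push Not at hm
  have hmn0 := mn_nonneg (by positivity : (0 : ℝ) ≤ B) y
  set T := ⌊mn B y / 8⌋₊ with hT
  have hT1 : (T : ℝ) ≤ mn B y / 8 := Nat.floor_le (by positivity)
  have hT2 : mn B y / 8 < T + 1 := Nat.lt_floor_add_one _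
  have hTB : T ≤ B := by
    have : (T : ℝ) ≤ B := by
      have := mn_le (by positivity : (0 : ℝ) ≤ B) y
      linarith
    exact_mod_cast this
  have h2 : ∑ L ∈ Finset.Icc 1 T, (1 : ℝ) / 4 ≤ ∑ L ∈ Finset.Icc 1 B, F L := by
    refine le_trans (Finset.sum_le_sum fun L hL => ?_) (Finset.sum_le_sum_of_subset_of_nonneg
      (Finset.Icc_subset_Icc_right hTB) fun i _ _ => hF0 i)
    rw [Finset.mem_Icc] at hL
    refine fejer_term hL.1 ?_
    have hLT : (L : ℝ) ≤ T := by exact_mod_cast hL.2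
    have := mn_mul_nint_le B y
    have h0 := nint_nonneg y
    nlinarith
  simp only [Finset.sum_const, Nat.card_Icc, nsmul_eq_mul, Nat.add_sub_cancel] at h2
  linarith

lemma sum_inv_le (B : ℕ) : ∑ L ∈ Finset.Icc 1 B, (1 : ℝ) / L ≤ 1 + Real.log B := by
  have := harmonic_le_one_add_log B
  rw [harmonic_eq_sum_Icc] at this
  push_cast at this
  simpa [one_div] using this

lemma fejer {ι : Type*} (s : Finset ι) (y : ι → ℝ) (B : ℕ) (hB : 1 ≤ B) :
    ∑ i ∈ s, mn B (y i) ≤ 128 * (1 + Real.log B) *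
      ∑ h ∈ Finset.range B, ‖∑ i ∈ s, e (h * y i)‖ := by
  set R := ∑ h ∈ Finset.range B, ‖∑ i ∈ s, e (h * y i)‖ with hR
  have hR0 : 0 ≤ R := Finset.sum_nonneg fun i _ => norm_nonneg _
  have key : ∀ L ∈ Finset.Icc 1 B,
      ∑ i ∈ s, ‖∑ l ∈ Finset.range L, e (l * y i)‖ ^ 2 / (L : ℝ) ^ 2 ≤ (2 * R) * (1 / L) := by
    intro L hL
    rw [Finset.mem_Icc] at hL
    have hL' : (1 : ℝ) ≤ L := by exact_mod_cast hL.1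
    rw [← Finset.sum_div, div_le_iff₀ (by positivity)]
    have h1 : ∀ i ∈ s, ‖∑ l ∈ Finset.range L, e (l * y i)‖ ^ 2 =
        L + 2 * (∑ h ∈ Finset.Ico 1 L, ((L - h : ℕ) : ℂ) * e (h * y i)).re := by
      intro i _
      rw [norm_sq_sum, sum_pairs L (fun k n => e (k * y i) * (starRingEnd ℂ) (e (n * y i)))]
      congr 1
      · simp [e_norm]
      · congr 2
        refine Finset.sum_congr rfl fun h _ => ?_
        have : ∀ n ∈ Finset.range (L - h), e ((n + h : ℕ) * y i) * (starRingEnd ℂ) (e (n * y i))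
            = e (h * y i) := by
          intro n _
          rw [e_conj, ← e_add]; congr 1; push_cast; ring
        rw [Finset.sum_congr rfl this]; simp
    rw [Finset.sum_congr rfl h1, Finset.sum_add_distrib, ← Finset.mul_sum, ← Complex.re_sum,
      Finset.sum_comm]
    have h2 : (∑ h ∈ Finset.Ico 1 L, ∑ i ∈ s, ((L - h : ℕ) : ℂ) * e (h * y i)).re
        ≤ L * ∑ h ∈ Finset.Ico 1 L, ‖∑ i ∈ s, e (h * y i)‖ := by
      refine (Complex.re_le_norm _).trans ((norm_sum_le _ _).trans ?_)
      rw [Finset.mul_sum]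
      refine Finset.sum_le_sum fun h _ => ?_
      rw [← Finset.mul_sum, norm_mul]
      gcongr
      rw [Complex.norm_natCast]
      exact_mod_cast Nat.sub_le L h
    have h3 : ∑ h ∈ Finset.range L, ‖∑ i ∈ s, e (h * y i)‖ ≤ R :=
      Finset.sum_le_sum_of_subset_of_nonneg (Finset.range_subset_range.2 hL.2)
        fun i _ _ => norm_nonneg _
    rw [Finset.range_eq_Ico, Finset.sum_eq_sum_Ico_succ_bot (by omega)] at h3
    simp only [Nat.cast_zero, zero_mul, e_zero, Finset.sum_const, nsmul_eq_mul, mul_one,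
      Complex.norm_natCast, zero_add] at h3 ⊢
    have h4 : 2 * R * (1 / L) * (L : ℝ) ^ 2 = 2 * (L * R) := by field_simp
    rw [h4]
    have h5 : (0 : ℝ) ≤ L * s.card := by positivity
    have h6 := mul_le_mul_of_nonneg_left h3 (by positivity : (0 : ℝ) ≤ L)
    have h7 : (0 : ℝ) ≤ L * ∑ h ∈ Finset.Ico 1 L, ‖∑ i ∈ s, e (h * y i)‖ := by positivity
    nlinarith
  calc ∑ i ∈ s, mn B (y i)
      ≤ ∑ i ∈ s, 64 * ∑ L ∈ Finset.Icc 1 B, ‖∑ l ∈ Finset.range L, e (l * y i)‖ ^ 2 / (L : ℝ) ^ 2 :=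
        Finset.sum_le_sum fun i _ => fejer_lower B hB _
    _ = 64 * ∑ L ∈ Finset.Icc 1 B,
          ∑ i ∈ s, ‖∑ l ∈ Finset.range L, e (l * y i)‖ ^ 2 / (L : ℝ) ^ 2 := by
        rw [← Finset.mul_sum, Finset.sum_comm]
    _ ≤ 64 * ∑ L ∈ Finset.Icc 1 B, (2 * R) * (1 / L) := by
        gcongr with L hL; exact key L hL
    _ ≤ 64 * ((2 * R) * (1 + Real.log B)) := by
        rw [← Finset.mul_sum]; gcongr; exact sum_inv_le B
    _ = _ := by ring

lemma spacing {α : ℝ} {a : ℤ} {q : ℕ} (hq : 1 ≤ q) (hg : Int.gcd a q = 1)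
    (hα : |α - (a : ℝ) / q| < 1 / (q : ℝ) ^ 2) {d : ℤ} (hd : d ≠ 0) (hdq : 2 * |d| ≤ q) (z : ℤ) :
    1 / (2 * (q : ℝ)) < |α * d - z| := by
  have hq' : (0 : ℝ) < q := by exact_mod_cast hq
  have h1 : a * d - z * q ≠ 0 := by
    intro h
    have h2 : (q : ℤ) ∣ a * d := ⟨z, by linarith⟩
    have h3 : (q : ℤ) ∣ d := by
      apply Int.dvd_of_dvd_mul_right_of_gcd_one h2
      rw [Int.gcd_comm]; exact hg
    have h4 := Int.le_of_dvd (abs_pos.2 hd) ((dvd_abs _ _).2 h3)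
    have : 0 < |d| := abs_pos.2 hd
    omega
  have h2 : (1 : ℝ) ≤ |(a * d - z * q : ℝ)| := by
    exact_mod_cast Int.one_le_abs h1
  have hd1 : (0 : ℝ) < |(d : ℝ)| := abs_pos.2 (by exact_mod_cast hd)
  have hd2 : 2 * |(d : ℝ)| ≤ q := by exact_mod_cast hdq
  have h3 : |(a * d - z * q : ℝ)| ≤ q * |α * d - z| + q * (|(d : ℝ)| * |α - a / q|) := by
    have : (a * d - z * q : ℝ) = q * (α * d - z) - q * (d * (α - a / q)) := by
      field_simp; ring
    rw [this]
    refine (abs_sub _ _).trans ?_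
    rw [abs_mul, abs_mul, abs_mul, abs_of_pos hq']
  have h4 : q * (|(d : ℝ)| * |α - a / q|) < 1 / 2 := by
    calc q * (|(d : ℝ)| * |α - a / q|) < q * (|(d : ℝ)| * (1 / (q : ℝ) ^ 2)) := by gcongr
      _ = (2 * |(d : ℝ)|) / (2 * q) := by field_simp
      _ ≤ q / (2 * q) := by gcongr
      _ = 1 / 2 := by field_simp
  rw [div_lt_iff₀ (by positivity)]
  linarith

lemma half_block {α : ℝ} {a : ℤ} {q : ℕ} (hq : 1 ≤ q) (hg : Int.gcd a q = 1)
    (hα : |α - (a : ℝ) / q| < 1 / (q : ℝ) ^ 2) {B : ℝ} (hB : 0 ≤ B) (F : Finset ℕ)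
    (hF : ∀ r ∈ F, ∀ r' ∈ F, 2 * |(r : ℤ) - r'| ≤ q)
    (hs : ∀ r ∈ F, ∀ r' ∈ F,
      |(α * r - round (α * r)) - (α * r' - round (α * r'))| = |nint (α * r) - nint (α * r')|) :
    ∑ r ∈ F, mn B (α * r) ≤ B + 2 * q * (1 + Real.log q) := by
  have hq' : (0 : ℝ) < q := by exact_mod_cast hq
  set k : ℕ → ℕ := fun r => ⌊2 * q * nint (α * r)⌋₊ with hk
  set g : ℕ → ℝ := fun k => if k = 0 then B else 2 * q * (1 / k) with hgdef
  have hinj : Set.InjOn k F := by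
    intro r hr r' hr' h
    by_contra hne
    have hd : (r : ℤ) - r' ≠ 0 := by
      intro h; apply hne; omega
    have h1 := spacing hq hg hα hd (hF r hr r' hr') (round (α * r) - round (α * r'))
    have h2 := hs r hr r' hr'
    have h3 : α * ((r : ℤ) - r' : ℤ) - (round (α * r) - round (α * r') : ℤ)
      = (α * r - round (α * r)) - (α * r' - round (α * r')) := by push_cast; ring
    rw [h3, h2, div_lt_iff₀ (by positivity)] at h1
    have e1 := Nat.floor_le (by have := nint_nonneg (α * r); positivity : 0 ≤ 2 * q * nint (α * r))
    have e2 := Nat.lt_floor_add_one (2 * q * nint (α * r))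
    have e3 := Nat.floor_le (by have := nint_nonneg (α * r'); positivity : 0 ≤ 2 * q * nint (α * r'))
    have e4 := Nat.lt_floor_add_one (2 * q * nint (α * r'))
    simp only [hk] at h
    rw [h] at e1 e2
    rcases abs_cases (nint (α * r) - nint (α * r')) with ⟨h5, _⟩ | ⟨h5, _⟩ <;>
      rw [h5] at h1 <;> nlinarith
  have hle : ∀ r ∈ F, mn B (α * r) ≤ g (k r) := by
    intro r _
    simp only [hgdef]
    split_ifs with h
    · exact mn_le hB _
    · have h0 : (0 : ℝ) < k r := by exact_mod_cast Nat.pos_of_ne_zero h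
      have e1 := Nat.floor_le (by have := nint_nonneg (α * r); positivity :
        0 ≤ 2 * q * nint (α * r))
      change (k r : ℝ) ≤ _ at e1
      have := mn_mul_nint_le B (α * r)
      rw [mul_one_div, le_div_iff₀ h0]
      calc mn B (α * r) * k r ≤ mn B (α * r) * (2 * q * nint (α * r)) := by
            gcongr; exact mn_nonneg hB _
        _ = 2 * q * (mn B (α * r) * nint (α * r)) := by ring
        _ ≤ 2 * q * 1 := by gcongr
        _ = _ := by ring
  have hg0 : ∀ k, 0 ≤ g k := by
    intro k; simp only [hgdef]; split_ifs <;> positivity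
  have himg : F.image k ⊆ Finset.range (q + 1) := by
    intro n hn
    rw [Finset.mem_image] at hn
    obtain ⟨r, _, rfl⟩ := hn
    rw [Finset.mem_range, Nat.lt_succ_iff]
    apply Nat.floor_le_of_le
    have := nint_le_half (α * r)
    nlinarith
  calc ∑ r ∈ F, mn B (α * r) ≤ ∑ r ∈ F, g (k r) := Finset.sum_le_sum hle
    _ = ∑ n ∈ F.image k, g n := (Finset.sum_image hinj).symm
    _ ≤ ∑ n ∈ Finset.range (q + 1), g n :=
        Finset.sum_le_sum_of_subset_of_nonneg himg fun i _ _ => hg0 i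
    _ = B + 2 * q * ∑ n ∈ Finset.Icc 1 q, (1 : ℝ) / n := by
        rw [Finset.range_eq_Ico, Finset.sum_eq_sum_Ico_succ_bot (by omega), Finset.mul_sum]
        congr 1
        refine Finset.sum_congr (by ext; simp) fun n hn => ?_
        simp only [Finset.mem_Icc] at hn
        have : n ≠ 0 := by omega
        simp [hgdef, this]
    _ ≤ _ := by gcongr; exact sum_inv_le q

lemma block {α : ℝ} {a : ℤ} {q : ℕ} (hq : 1 ≤ q) (hg : Int.gcd a q = 1)
    (hα : |α - (a : ℝ) / q| < 1 / (q : ℝ) ^ 2) {B : ℝ} (hB : 0 ≤ B) (n0 : ℕ) :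
    ∑ r ∈ Finset.range (q / 2 + 1), mn B (α * (n0 + r : ℕ)) ≤
      2 * (B + 2 * q * (1 + Real.log q)) := by
  have h0 : ∑ r ∈ Finset.range (q / 2 + 1), mn B (α * (n0 + r : ℕ))
      = ∑ r ∈ Finset.Ico n0 (n0 + (q / 2 + 1)), mn B (α * r) := by
    rw [Finset.sum_Ico_eq_sum_range]; simp
  rw [h0, ← Finset.sum_filter_add_sum_filter_not _ (fun r : ℕ => 0 ≤ α * r - round (α * r)), two_mul]
  refine add_le_add (half_block hq hg hα hB _ ?_ ?_) (half_block hq hg hα hB _ ?_ ?_)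
  · intro r hr r' hr'
    simp only [Finset.mem_filter, Finset.mem_Ico] at hr hr'
    rcases abs_cases ((r : ℤ) - r') with h | h <;> omega
  · intro r hr r' hr'
    simp only [Finset.mem_filter] at hr hr'
    unfold nint
    rw [abs_of_nonneg hr.2, abs_of_nonneg hr'.2]
  · intro r hr r' hr'
    simp only [Finset.mem_filter, Finset.mem_Ico] at hr hr'
    rcases abs_cases ((r : ℤ) - r') with h | h <;> omega
  · intro r hr r' hr'
    simp only [Finset.mem_filter, not_le] at hr hr'
    unfold nint
    rw [abs_of_neg hr.2, abs_of_neg hr'.2, ← abs_neg]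
    congr 1; ring

lemma sum_range_blocks (f : ℕ → ℝ) (K L : ℕ) :
    ∑ n ∈ Finset.range (K * L), f n
      = ∑ i ∈ Finset.range K, ∑ r ∈ Finset.range L, f (i * L + r) := by
  induction K with
  | zero => simp
  | succ K ih => rw [Finset.sum_range_succ, ← ih, Nat.succ_mul, Finset.sum_range_add]

lemma count {α : ℝ} {a : ℤ} {q : ℕ} (hq : 1 ≤ q) (hg : Int.gcd a q = 1)
    (hα : |α - (a : ℝ) / q| < 1 / (q : ℝ) ^ 2) {B : ℝ} (hB : 0 ≤ B) (X : ℕ) :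
    ∑ n ∈ Finset.Icc 1 X, mn B (α * n) ≤
      (2 * (X + 1) / q + 1) * (2 * (B + 2 * q * (1 + Real.log q))) := by
  have hq' : (1 : ℝ) ≤ q := by exact_mod_cast hq
  have hlog : 0 ≤ Real.log q := Real.log_nonneg hq'
  set L := q / 2 + 1 with hL
  set K := (X + 1) / L + 1 with hK
  have h1 : Finset.Icc 1 X ⊆ Finset.range (K * L) := by
    intro n hn
    rw [Finset.mem_Icc] at hn
    rw [Finset.mem_range]
    have h2 : X + 1 < L * ((X + 1) / L + 1) := Nat.lt_mul_div_succ _ (by omega)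
    rw [hK, mul_comm]; omega
  refine (Finset.sum_le_sum_of_subset_of_nonneg h1 fun i _ _ => mn_nonneg hB _).trans ?_
  rw [sum_range_blocks (fun n : ℕ => mn B (α * n))]
  refine (Finset.sum_le_sum fun i _ => block hq hg hα hB (i * L)).trans ?_
  rw [Finset.sum_const, Finset.card_range, nsmul_eq_mul]
  gcongr
  have hLr : (q : ℝ) / 2 ≤ L := by
    have : q ≤ 2 * L := by omega
    have : (q : ℝ) ≤ 2 * L := by exact_mod_cast this
    linarith
  rw [hK]; push_cast
  gcongr ?_ + 1
  calc (((X + 1) / L : ℕ) : ℝ) ≤ ((X + 1 : ℕ) : ℝ) / L := Nat.cast_div_le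
    _ ≤ ((X + 1 : ℕ) : ℝ) / (q / 2) := by gcongr
    _ = _ := by push_cast; field_simp

lemma combine {f : ℕ → ℝ} (hf : ∀ n, 0 ≤ f n) (A B : Finset ℕ) {N : ℕ} {E : ℝ}
    (hA : ∀ a ∈ A, 1 ≤ a) (hB : ∀ b ∈ B, 1 ≤ b) (hN : ∀ a ∈ A, ∀ b ∈ B, a * b ≤ N)
    (hE : ∀ n : ℕ, 1 ≤ n → n ≤ N → (n.divisors.card : ℝ) ≤ E) :
    ∑ a ∈ A, ∑ b ∈ B, f (a * b) ≤ E * ∑ n ∈ Finset.Icc 1 N, f n := by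
  have hmaps : ∀ p ∈ A ×ˢ B, p.1 * p.2 ∈ Finset.Icc 1 N := by
    intro p hp
    rw [Finset.mem_product] at hp
    rw [Finset.mem_Icc]
    exact ⟨Nat.mul_pos (hA _ hp.1) (hB _ hp.2), hN _ hp.1 _ hp.2⟩
  rw [← Finset.sum_product' A B (fun a b => f (a * b)), ← Finset.sum_fiberwise_of_maps_to hmaps,
    Finset.mul_sum]
  refine Finset.sum_le_sum fun n hn => ?_
  rw [Finset.mem_Icc] at hn
  have h1 : ∀ p ∈ (A ×ˢ B).filter (fun p => p.1 * p.2 = n), f (p.1 * p.2) = f n := by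
    intro p hp
    rw [(Finset.mem_filter.1 hp).2]
  rw [Finset.sum_congr rfl h1, Finset.sum_const, nsmul_eq_mul]
  refine mul_le_mul_of_nonneg_right ?_ (hf n)
  refine le_trans ?_ (hE n hn.1 hn.2)
  norm_cast
  refine Finset.card_le_card_of_injOn Prod.fst ?_ ?_
  · intro p hp
    have hp2 := (Finset.mem_filter.1 hp).2
    simp only [Finset.mem_coe, Nat.mem_divisors]
    exact ⟨⟨p.2, hp2.symm⟩, by omega⟩
  · intro p hp p' hp' h
    have hp2 := (Finset.mem_filter.1 hp)
    have hp3 := (Finset.mem_filter.1 hp')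
    have h1 := hA _ (Finset.mem_product.1 hp2.1).1
    refine Prod.ext h ?_
    have : p.1 * p.2 = p.1 * p'.2 := by rw [hp2.2, h, hp3.2]
    exact Nat.eq_of_mul_eq_mul_left h1 this

lemma tauk_le (k n : ℕ) (hn : 1 ≤ n) : tauk k n ≤ n.divisors.card ^ k := by
  unfold tauk
  calc _ ≤ (Fintype.piFinset fun _ : Fin k => n.divisors).card := by
        refine Finset.card_le_card fun t ht => ?_
        rw [Finset.mem_filter] at ht
        rw [Fintype.mem_piFinset]
        intro i
        rw [Nat.mem_divisors]
        refine ⟨?_, by omega⟩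
        rw [← ht.2]
        exact Finset.dvd_prod_of_mem _ (Finset.mem_univ i)
    _ = _ := by simp

lemma divisor_bound (δ : ℝ) (hδ : 0 < δ) :
    ∃ C : ℝ, 1 ≤ C ∧ ∀ n : ℕ, 1 ≤ n → (n.divisors.card : ℝ) ≤ C * (n : ℝ) ^ δ := by
  set c : ℝ := max 1 (1 / (δ * Real.log 2)) with hc
  have hl2 : 0 < Real.log 2 := Real.log_pos (by norm_num)
  have hc1 : 1 ≤ c := le_max_left _ _
  have hc2 : 1 ≤ c * (δ * Real.log 2) := by
    have : 1 / (δ * Real.log 2) ≤ c := le_max_right _ _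
    rwa [div_le_iff₀ (by positivity)] at this
  set K := ⌈(2 : ℝ) ^ (1 / δ)⌉₊ with hK
  refine ⟨c ^ K, one_le_pow₀ hc1, fun n hn => ?_⟩
  have hn0 : n ≠ 0 := by omega
  have term : ∀ p ∈ n.primeFactors, ((n.factorization p + 1 : ℕ) : ℝ) ≤
      (if p < K then c else 1) * ((p : ℝ) ^ n.factorization p) ^ δ := by
    intro p hp
    have hp2 : (2 : ℝ) ≤ p := by exact_mod_cast (Nat.prime_of_mem_primeFactors hp).two_le
    set k := n.factorization p
    have h1 : ((p : ℝ) ^ k) ^ δ = ((p : ℝ) ^ δ) ^ k := by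
      rw [← Real.rpow_natCast, ← Real.rpow_mul (by positivity), mul_comm, Real.rpow_mul
        (by positivity), Real.rpow_natCast]
    push_cast
    split_ifs with h
    · have h2 : 1 + (k : ℝ) * (δ * Real.log 2) ≤ ((p : ℝ) ^ k) ^ δ := by
        have : ((2 : ℝ) ^ k) ^ δ ≤ ((p : ℝ) ^ k) ^ δ := by gcongr
        refine le_trans ?_ this
        rw [Real.rpow_def_of_pos (by positivity), Real.log_pow]
        have := Real.add_one_le_exp (k * Real.log 2 * δ)
        linarith
      have hk : (0 : ℝ) ≤ k := by positivity
      nlinarith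
    · push Not at h
      rw [one_mul, h1]
      have h2 : (2 : ℝ) ≤ (p : ℝ) ^ δ := by
        have h3 : (2 : ℝ) ^ (1 / δ) ≤ p := (Nat.le_ceil _).trans (by exact_mod_cast h)
        calc (2 : ℝ) = ((2 : ℝ) ^ (1 / δ)) ^ δ := by
              rw [← Real.rpow_mul (by norm_num), one_div, inv_mul_cancel₀ hδ.ne', Real.rpow_one]
          _ ≤ _ := by gcongr
      calc (k : ℝ) + 1 ≤ 2 ^ k := by exact_mod_cast Nat.lt_two_pow_self
        _ ≤ _ := by gcongr
  rw [Nat.card_divisors hn0]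
  push_cast
  push_cast at term
  refine (Finset.prod_le_prod (fun i _ => by positivity) term).trans ?_
  rw [Finset.prod_mul_distrib]
  have h2 : ∏ p ∈ n.primeFactors, ((p : ℝ) ^ n.factorization p) ^ δ = (n : ℝ) ^ δ := by
    rw [Real.finsetProd_rpow _ _ (fun i _ => by positivity)]
    congr 1
    have := Nat.prod_factorization_pow_eq_self hn0
    rw [Finsupp.prod, Nat.support_factorization] at this
    exact_mod_cast this
  rw [h2]
  gcongr
  rw [← Finset.prod_filter, Finset.prod_const]
  refine pow_le_pow_right₀ hc1 ?_
  calc _ ≤ (Finset.range K).card := by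
        refine Finset.card_le_card fun p hp => ?_
        simpa using (Finset.mem_filter.1 hp).2
    _ = K := by simp


lemma scale_sum {f : ℕ → ℝ} (hf : ∀ n, 0 ≤ f n) (c N : ℕ) (hc : 1 ≤ c) :
    ∑ n ∈ Finset.Icc 1 N, f (c * n) ≤ ∑ n ∈ Finset.Icc 1 (c * N), f n := by
  have hinj : Set.InjOn (fun n => c * n) (Finset.Icc 1 N : Finset ℕ) := by
    intro a _ b _ h
    exact Nat.eq_of_mul_eq_mul_left hc h
  rw [← Finset.sum_image (f := f) hinj]
  refine Finset.sum_le_sum_of_subset_of_nonneg ?_ fun i _ _ => hf i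
  intro n hn
  rw [Finset.mem_image] at hn
  obtain ⟨k, hk, rfl⟩ := hn
  rw [Finset.mem_Icc] at hk ⊢
  exact ⟨Nat.mul_pos hc hk.1, Nat.mul_le_mul_left _ hk.2⟩

/-- Divisor bound hypothesis up to `N`. -/
def DivB (N : ℕ) (E : ℝ) : Prop := ∀ n : ℕ, 1 ≤ n → n ≤ N → (n.divisors.card : ℝ) ≤ E

lemma DivB.mono {N N' : ℕ} {E : ℝ} (h : DivB N E) (hN : N' ≤ N) : DivB N' E :=
  fun n h1 h2 => h n h1 (h2.trans hN)

lemma R_step (α : ℝ) (V B a b : ℕ) (hb : b ≤ B) (E : ℝ) (hE : DivB (2 * (B * V)) E) :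
    (∑ v ∈ Finset.Icc 1 V, ‖∑ s ∈ Finset.Ico a b, e (α * v * s ^ 2)‖) ^ 2 ≤
      V * (V * B + 2 * (E * ∑ n ∈ Finset.Icc 1 (2 * (B * V)), mn B (α * n))) := by
  refine sq_sum_le_card_mul_sum_sq.trans ?_
  rw [Nat.card_Icc, Nat.add_sub_cancel]
  gcongr
  have h1 : ∀ v ∈ Finset.Icc 1 V, ‖∑ s ∈ Finset.Ico a b, e (α * v * s ^ 2)‖ ^ 2 ≤
      B + 2 * ∑ h ∈ Finset.Ico 1 B, mn B (α * (2 * (v * h) : ℕ)) := by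
    intro v _
    rw [Finset.sum_Ico_eq_sum_range]
    have : ∀ n ∈ Finset.range (b - a), e (α * v * (a + n : ℕ) ^ 2) =
        e ((α * v) * n ^ 2 + (2 * a * (α * v)) * n + α * v * a ^ 2) := by
      intro n _; congr 1; push_cast; ring
    rw [Finset.sum_congr rfl this]
    refine (weyl_quad _ B (by omega) _ _ _).trans (le_of_eq ?_)
    congr 2
    refine Finset.sum_congr rfl fun h _ => ?_
    congr 1; push_cast; ring
  refine (Finset.sum_le_sum h1).trans ?_
  rw [Finset.sum_add_distrib, ← Finset.mul_sum]
  have h0 : ∀ n : ℕ, 0 ≤ mn B (α * n) := fun n => mn_nonneg (by positivity) _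
  have hc := combine (f := fun n : ℕ => mn B (α * (2 * n : ℕ))) (fun n => h0 _) (Finset.Icc 1 V)
    (Finset.Ico 1 B) (N := B * V) (E := E) (fun a ha => (Finset.mem_Icc.1 ha).1)
    (fun a ha => (Finset.mem_Ico.1 ha).1) (by
      intro a ha b hb
      rw [mul_comm]
      exact Nat.mul_le_mul (Finset.mem_Ico.1 hb).2.le (Finset.mem_Icc.1 ha).2)
      (hE.mono (by omega))
  have hs := scale_sum (f := fun n : ℕ => mn B (α * n)) h0 2 (B * V) (by norm_num)
  gcongr
  · simp
  · refine hc.trans ?_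
    rcases Nat.eq_zero_or_pos (B * V) with h | h
    · simp [h]
    · have : 0 ≤ E := le_trans (by positivity) (hE 1 le_rfl (by omega))
      gcongr

lemma norm_sum_le_card (s : Finset ℕ) (f : ℕ → ℝ) : ‖∑ i ∈ s, e (f i)‖ ≤ s.card := by
  refine (norm_sum_le _ _).trans ?_
  simp [e_norm]

lemma Q_step (α : ℝ) (W A B a b : ℕ) (hA : 1 ≤ A) (hb : b ≤ B) (E : ℝ) (hE : DivB (A * W) E) :
    ∑ w ∈ Finset.Icc 1 W, ∑ s ∈ Finset.Ico a b, mn A (α * w * s ^ 2) ≤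
      128 * (1 + Real.log A) * (W * B + E *
        ∑ v ∈ Finset.Icc 1 (A * W), ‖∑ s ∈ Finset.Ico a b, e (α * v * s ^ 2)‖) := by
  rw [← Finset.sum_product' _ _ (fun (w s : ℕ) => mn A (α * w * s ^ 2))]
  refine (fejer _ (fun p : ℕ × ℕ => α * p.1 * p.2 ^ 2) A hA).trans ?_
  have hl : 0 ≤ 1 + Real.log A := by have := Real.log_natCast_nonneg A; linarith
  gcongr
  rw [Finset.range_eq_Ico, Finset.sum_eq_sum_Ico_succ_bot (by omega)]
  gcongr ?_ + ?_
  · simp only [Nat.cast_zero, zero_mul, e_zero, Finset.sum_const, nsmul_eq_mul, mul_one,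
      Complex.norm_natCast, Finset.card_product, Nat.card_Icc, Nat.card_Ico, Nat.add_sub_cancel]
    push_cast
    gcongr
    omega
  · have hc := combine (f := fun v : ℕ => ‖∑ s ∈ Finset.Ico a b, e (α * v * s ^ 2)‖)
      (fun n => norm_nonneg _) (Finset.Ico 1 A) (Finset.Icc 1 W) (N := A * W) (E := E)
      (fun a ha => (Finset.mem_Ico.1 ha).1)
      (fun a ha => (Finset.mem_Icc.1 ha).1) (by
        intro a ha b hb
        exact Nat.mul_le_mul (Finset.mem_Ico.1 ha).2.le (Finset.mem_Icc.1 hb).2) hE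
    refine le_trans (Finset.sum_le_sum fun h _ => ?_) hc
    rw [Finset.sum_product]
    refine (norm_sum_le _ _).trans (Finset.sum_le_sum fun w _ => le_of_eq ?_)
    congr 1
    refine Finset.sum_congr rfl fun s _ => ?_
    congr 1; push_cast; ring

lemma pow_four_sum_le {ι : Type*} (s : Finset ι) (f : ι → ℝ) :
    (∑ i ∈ s, f i) ^ 4 ≤ (s.card : ℝ) ^ 3 * ∑ i ∈ s, f i ^ 4 := by
  have h1 : (∑ i ∈ s, f i) ^ 2 ≤ s.card * ∑ i ∈ s, f i ^ 2 := sq_sum_le_card_mul_sum_sq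
  have h2 : (∑ i ∈ s, f i ^ 2) ^ 2 ≤ s.card * ∑ i ∈ s, (f i ^ 2) ^ 2 := sq_sum_le_card_mul_sum_sq
  have h3 : ∑ i ∈ s, (f i ^ 2) ^ 2 = ∑ i ∈ s, f i ^ 4 :=
    Finset.sum_congr rfl fun i _ => by ring
  rw [h3] at h2
  calc (∑ i ∈ s, f i) ^ 4 = ((∑ i ∈ s, f i) ^ 2) ^ 2 := by ring
    _ ≤ (s.card * ∑ i ∈ s, f i ^ 2) ^ 2 := by gcongr
    _ = (s.card : ℝ) ^ 2 * (∑ i ∈ s, f i ^ 2) ^ 2 := by ring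
    _ ≤ (s.card : ℝ) ^ 2 * (s.card * ∑ i ∈ s, f i ^ 4) := by gcongr
    _ = _ := by ring

lemma T_step (α : ℝ) (U A B a b c d : ℕ) (hA : 1 ≤ A) (hb : b ≤ B) (hd : d ≤ A) (E : ℝ)
    (hE1 : 1 ≤ E) (hE : DivB (6 * (U * A * A)) E) :
    (∑ u ∈ Finset.Icc 1 U, ∑ s ∈ Finset.Ico a b,
        ‖∑ m ∈ Finset.Ico c d, e (α * u * s ^ 2 * m ^ 3)‖) ^ 4 ≤
      ((U : ℝ) * B) ^ 3 * (10 * (U * B) * A ^ 3 + 16 * A * (E ^ 2 *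
        ∑ w ∈ Finset.Icc 1 (6 * (U * A * A)), ∑ s ∈ Finset.Ico a b, mn A (α * w * s ^ 2))) := by
  have hcard : (((Finset.Icc 1 U ×ˢ Finset.Ico a b).card : ℕ) : ℝ) ≤ U * B := by
    rw [Finset.card_product, Nat.card_Icc, Nat.card_Ico, Nat.add_sub_cancel]
    push_cast
    gcongr
    omega
  rw [← Finset.sum_product' _ _
    (fun (u s : ℕ) => ‖∑ m ∈ Finset.Ico c d, e (α * u * s ^ 2 * m ^ 3)‖)]
  refine (pow_four_sum_le _ _).trans ?_
  have hmn : ∀ y, 0 ≤ mn A y := fun y => mn_nonneg (by positivity) y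
  gcongr
  have h1 : ∀ p ∈ Finset.Icc 1 U ×ˢ Finset.Ico a b,
      ‖∑ m ∈ Finset.Ico c d, e (α * p.1 * p.2 ^ 2 * m ^ 3)‖ ^ 4 ≤
      10 * (A : ℝ) ^ 3 + 16 * A * ∑ h₁ ∈ Finset.Ico 1 A, ∑ h₂ ∈ Finset.Ico 1 A,
        mn A (α * p.1 * p.2 ^ 2 * (6 * (h₁ * h₂) : ℕ)) := by
    intro p _
    rw [Finset.sum_Ico_eq_sum_range]
    exact weyl_cubic _ A (by omega) _ _
  refine (Finset.sum_le_sum h1).trans ?_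
  rw [Finset.sum_add_distrib, Finset.sum_const, nsmul_eq_mul, ← Finset.mul_sum]
  gcongr ?_ + 16 * A * ?_
  · calc _ ≤ (U * B : ℝ) * (10 * A ^ 3) := by gcongr
      _ = _ := by ring
  rw [Finset.sum_product_right, Finset.sum_comm (s := Finset.Icc 1 (6 * (U * A * A))),
    Finset.mul_sum]
  refine Finset.sum_le_sum fun s _ => ?_
  set g : ℕ → ℝ := fun n => mn A (α * n * s ^ 2) with hg
  have hg0 : ∀ n, 0 ≤ g n := fun n => hmn _
  have e1 : ∀ u ∈ Finset.Icc 1 U, ∑ h₁ ∈ Finset.Ico 1 A, ∑ h₂ ∈ Finset.Ico 1 A,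
      mn A (α * u * s ^ 2 * (6 * (h₁ * h₂) : ℕ)) =
      ∑ h₁ ∈ Finset.Ico 1 A, ∑ h₂ ∈ Finset.Ico 1 A, g (6 * (u * h₁ * h₂)) := by
    intro u _
    refine Finset.sum_congr rfl fun h₁ _ => Finset.sum_congr rfl fun h₂ _ => ?_
    simp only [hg]; congr 1; push_cast; ring
  simp only
  rw [Finset.sum_congr rfl e1]
  have c1 := combine (f := fun n => ∑ h₂ ∈ Finset.Ico 1 A, g (6 * (n * h₂)))
    (fun n => Finset.sum_nonneg fun i _ => hg0 _) (Finset.Icc 1 U) (Finset.Ico 1 A)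
    (N := U * A) (E := E) (fun a ha => (Finset.mem_Icc.1 ha).1)
    (fun a ha => (Finset.mem_Ico.1 ha).1)
    (fun a ha b hb => Nat.mul_le_mul (Finset.mem_Icc.1 ha).2 (Finset.mem_Ico.1 hb).2.le)
    (hE.mono (by nlinarith [Nat.le_mul_of_pos_right (U * A) hA]))
  have c2 := combine (f := fun n => g (6 * n))
    (fun n => hg0 _) (Finset.Icc 1 (U * A)) (Finset.Ico 1 A)
    (N := U * A * A) (E := E) (fun a ha => (Finset.mem_Icc.1 ha).1)
    (fun a ha => (Finset.mem_Ico.1 ha).1)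
    (fun a ha b hb => Nat.mul_le_mul (Finset.mem_Icc.1 ha).2 (Finset.mem_Ico.1 hb).2.le)
    (hE.mono (by omega))
  have c3 := scale_sum hg0 6 (U * A * A) (by norm_num)
  refine c1.trans ?_
  calc _ ≤ E * (E * ∑ n ∈ Finset.Icc 1 (U * A * A), g (6 * n)) := by gcongr
    _ ≤ E * (E * ∑ n ∈ Finset.Icc 1 (6 * (U * A * A)), g n) := by gcongr
    _ = _ := by ring

lemma G_step (α : ℝ) (H A B J a b c d j₀ j₁ : ℕ) (hH : 1 ≤ H) (hb : b ≤ B) (hd : d ≤ A)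
    (hj0 : 1 ≤ j₀) (hj : j₁ ≤ J) (E : ℝ) (hE : DivB (H * J) E) :
    ∑ m ∈ Finset.Ico c d, ∑ s ∈ Finset.Ico a b, ∑ j ∈ Finset.Ico j₀ j₁,
        mn H (α * ((m : ℝ) ^ 3 * (s : ℝ) ^ 2 * (j : ℝ))) ≤
      128 * (1 + Real.log H) * (A * B * J + E *
        ∑ u ∈ Finset.Icc 1 (H * J), ∑ s ∈ Finset.Ico a b,
          ‖∑ m ∈ Finset.Ico c d, e (α * u * s ^ 2 * m ^ 3)‖) := by
  have h0 : ∑ m ∈ Finset.Ico c d, ∑ s ∈ Finset.Ico a b, ∑ j ∈ Finset.Ico j₀ j₁,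
        mn H (α * ((m : ℝ) ^ 3 * (s : ℝ) ^ 2 * (j : ℝ)))
      = ∑ p ∈ Finset.Ico c d ×ˢ Finset.Ico a b ×ˢ Finset.Ico j₀ j₁,
        mn H (α * ((p.1 : ℝ) ^ 3 * (p.2.1 : ℝ) ^ 2 * (p.2.2 : ℝ))) := by
    rw [Finset.sum_product]
    refine Finset.sum_congr rfl fun m _ => ?_
    rw [Finset.sum_product]
  rw [h0]
  refine (fejer _ (fun p : ℕ × ℕ × ℕ => α * ((p.1 : ℝ) ^ 3 * (p.2.1 : ℝ) ^ 2 * (p.2.2 : ℝ)))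
    H hH).trans ?_
  have hl : 0 ≤ 1 + Real.log H := by have := Real.log_natCast_nonneg H; linarith
  gcongr
  rw [Finset.range_eq_Ico, Finset.sum_eq_sum_Ico_succ_bot (by omega)]
  gcongr ?_ + ?_
  · simp only [Nat.cast_zero, zero_mul, e_zero, Finset.sum_const, nsmul_eq_mul, mul_one,
      Complex.norm_natCast, Finset.card_product, Nat.card_Ico]
    push_cast
    rw [mul_assoc]
    gcongr <;> omega
  · have hc := combine (f := fun u : ℕ => ∑ s ∈ Finset.Ico a b,
          ‖∑ m ∈ Finset.Ico c d, e (α * u * s ^ 2 * m ^ 3)‖)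
      (fun n => Finset.sum_nonneg fun i _ => norm_nonneg _)
      (Finset.Ico 1 H) (Finset.Ico j₀ j₁) (N := H * J) (E := E)
      (fun a ha => (Finset.mem_Ico.1 ha).1)
      (fun a ha => hj0.trans (Finset.mem_Ico.1 ha).1) (by
        intro a ha b hb
        exact Nat.mul_le_mul (Finset.mem_Ico.1 ha).2.le ((Finset.mem_Ico.1 hb).2.le.trans hj)) hE
    refine le_trans (Finset.sum_le_sum fun h _ => ?_) hc
    have e1 : ∑ p ∈ Finset.Ico c d ×ˢ Finset.Ico a b ×ˢ Finset.Ico j₀ j₁,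
        e (h * (α * ((p.1 : ℝ) ^ 3 * (p.2.1 : ℝ) ^ 2 * (p.2.2 : ℝ))))
        = ∑ j ∈ Finset.Ico j₀ j₁, ∑ s ∈ Finset.Ico a b, ∑ m ∈ Finset.Ico c d,
          e (α * (h * j : ℕ) * s ^ 2 * m ^ 3) := by
      rw [Finset.sum_product_right, Finset.sum_product_right]
      refine Finset.sum_congr rfl fun j _ => Finset.sum_congr rfl fun s _ =>
        Finset.sum_congr rfl fun m _ => ?_
      congr 1; push_cast; ring
    rw [e1]
    refine (norm_sum_le _ _).trans (Finset.sum_le_sum fun j _ => ?_)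
    exact norm_sum_le _ _


lemma Z_num {x S E y q Y B L : ℝ} (hS : 1 ≤ S) (hq : 1 ≤ q) (hE : 1 ≤ E) (hx : S ^ 2 ≤ x)
    (hy : 0 ≤ y)
    (h1 : 1 / S ≤ y) (h2 : 1 / q ≤ y) (h3 : q / x ≤ y) (hY : Y ≤ 49152 * (x / S))
    (hB0 : 0 ≤ B) (hB : B ≤ 2 * S) (hL0 : 0 ≤ L) (hL : L ≤ E) (hY0 : 0 ≤ Y) :
    (2 * (Y + 1) / q + 1) * (2 * (B + 2 * q * L)) ≤ 2000000 * (E * x * y) := by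
  have hx0 : 0 < x := by nlinarith
  have hS0 : 0 < S := by linarith
  have hq0 : 0 < q := by linarith
  have hxS : S ≤ x / S := by rw [le_div_iff₀ hS0]; nlinarith
  have a1 : x / S ≤ x * y := by
    calc x / S = x * (1 / S) := by ring
      _ ≤ _ := by gcongr
  have a2 : x / q ≤ x * y := by
    calc x / q = x * (1 / q) := by ring
      _ ≤ _ := by gcongr
  have a3 : q ≤ x * y := by
    calc q = x * (q / x) := by field_simp
      _ ≤ _ := by gcongr
  have b1 : 2 * (Y + 1) / q + 1 ≤ 98306 * ((x / S) / q + 1) := by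
    have : 2 * (Y + 1) / q ≤ (98306 * (x / S)) / q :=
      div_le_div_of_nonneg_right (by linarith) hq0.le
    have e : (98306 * (x / S)) / q = 98306 * ((x / S) / q) := by ring
    linarith
  have b2 : 2 * (B + 2 * q * L) ≤ 4 * E * (S + q) := by
    have : q * L ≤ q * E := by gcongr
    nlinarith
  calc (2 * (Y + 1) / q + 1) * (2 * (B + 2 * q * L))
      ≤ (98306 * ((x / S) / q + 1)) * (4 * E * (S + q)) := by gcongr
    _ = 393224 * E * (x / q + x / S + S + q) := by field_simp; ring
    _ ≤ 393224 * E * (4 * (x * y)) := by gcongr; linarith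
    _ ≤ _ := by
      have : 0 ≤ E * x * y := by positivity
      nlinarith

lemma R_num {x S E y V B Z R : ℝ} (hS : 1 ≤ S) (hE : 1 ≤ E) (hx : 0 < x) (hy : 0 ≤ y)
    (h1 : 1 / S ≤ y ^ 8) (hV0 : 0 ≤ V) (hV : V ≤ 12288 * (x / S ^ 2)) (hB0 : 0 ≤ B)
    (hB : B ≤ 2 * S) (hZ : Z ≤ 2000000 * (E * x * y ^ 8))
    (hR : R ^ 2 ≤ V * (V * B + 2 * (E * Z))) :
    R ≤ 250000 * (E * (x / S) * y ^ 4) := by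
  have hS0 : 0 < S := by linarith
  have a1 : V * B ≤ 24576 * (x * y ^ 8) := by
    calc V * B ≤ (12288 * (x / S ^ 2)) * (2 * S) := by gcongr
      _ = 24576 * (x * (1 / S)) := by field_simp; ring
      _ ≤ _ := by gcongr
  have a2 : V * B + 2 * (E * Z) ≤ 5000000 * (E ^ 2 * x * y ^ 8) := by
    have : E * Z ≤ E * (2000000 * (E * x * y ^ 8)) := by gcongr
    have h : x * y ^ 8 ≤ E ^ 2 * (x * y ^ 8) :=
      le_mul_of_one_le_left (by positivity) (one_le_pow₀ hE)
    have : 0 ≤ x * y ^ 8 := by positivity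
    nlinarith
  have a3 : R ^ 2 ≤ (250000 * (E * (x / S) * y ^ 4)) ^ 2 := by
    calc R ^ 2 ≤ V * (V * B + 2 * (E * Z)) := hR
      _ ≤ V * (5000000 * (E ^ 2 * x * y ^ 8)) := by gcongr
      _ ≤ (12288 * (x / S ^ 2)) * (5000000 * (E ^ 2 * x * y ^ 8)) := by gcongr
      _ = 61440000000 * (E * (x / S) * y ^ 4) ^ 2 := by field_simp; ring
      _ ≤ 250000 ^ 2 * (E * (x / S) * y ^ 4) ^ 2 := by
        gcongr; norm_num
      _ = _ := by ring
  exact le_of_sq_le_sq a3 (by positivity)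

lemma Q_num {x M S E y W B R Q L : ℝ} (hM : 1 ≤ M) (hS : 1 ≤ S) (hE : 1 ≤ E) (hx : 0 < x)
    (hy : 0 ≤ y)
    (h1 : 1 / M ≤ y ^ 4) (hW0 : 0 ≤ W) (hW : W ≤ 6144 * (x / (M * S ^ 2))) (hB0 : 0 ≤ B)
    (hB : B ≤ 2 * S) (hR0 : 0 ≤ R) (hR : R ≤ 250000 * (E * (x / S) * y ^ 4))
    (hL0 : 0 ≤ L) (hL : L ≤ E) (hQ : Q ≤ 128 * L * (W * B + E * R)) :
    Q ≤ 40000000 * (E ^ 3 * (x / S) * y ^ 4) := by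
  have hS0 : 0 < S := by linarith
  have hM0 : 0 < M := by linarith
  have a1 : W * B ≤ 12288 * (x / S * y ^ 4) := by
    calc W * B ≤ (6144 * (x / (M * S ^ 2))) * (2 * S) := by gcongr
      _ = 12288 * (x / S * (1 / M)) := by field_simp; ring
      _ ≤ _ := by gcongr
  have a2 : W * B + E * R ≤ 300000 * (E ^ 2 * (x / S) * y ^ 4) := by
    have : E * R ≤ E * (250000 * (E * (x / S) * y ^ 4)) := by gcongr
    have h : x / S * y ^ 4 ≤ E ^ 2 * (x / S * y ^ 4) :=
      le_mul_of_one_le_left (by positivity) (one_le_pow₀ hE)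
    have : 0 ≤ x / S * y ^ 4 := by positivity
    nlinarith
  calc Q ≤ 128 * L * (W * B + E * R) := hQ
    _ ≤ 128 * E * (300000 * (E ^ 2 * (x / S) * y ^ 4)) := by gcongr
    _ = 38400000 * (E ^ 3 * (x / S) * y ^ 4) := by ring
    _ ≤ _ := by gcongr; norm_num

lemma T_num {x M S E y U A B Q T : ℝ} (hM : 1 ≤ M) (hS : 1 ≤ S) (hE : 1 ≤ E) (hx : 0 < x)
    (hy : 0 ≤ y)
    (h1 : 1 / M ≤ y ^ 4) (hU0 : 0 ≤ U) (hU : U ≤ 256 * (x / (M ^ 3 * S ^ 2))) (hB0 : 0 ≤ B)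
    (hB : B ≤ 2 * S) (hA0 : 0 ≤ A) (hA : A ≤ 2 * M) (hQ0 : 0 ≤ Q)
    (hQ : Q ≤ 40000000 * (E ^ 3 * (x / S) * y ^ 4))
    (hT : T ^ 4 ≤ (U * B) ^ 3 * (10 * (U * B) * A ^ 3 + 16 * A * (E ^ 2 * Q))) :
    T ≤ 21500 * (E ^ 2 * (x / (M ^ 2 * S)) * y) := by
  have hS0 : 0 < S := by linarith
  have hM0 : 0 < M := by linarith
  have a1 : U * B ≤ 512 * (x / (M ^ 3 * S)) := by
    calc U * B ≤ (256 * (x / (M ^ 3 * S ^ 2))) * (2 * S) := by gcongr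
      _ = _ := by field_simp; ring
  have hUB : 0 ≤ U * B := by positivity
  have a2 : 10 * (U * B) * A ^ 3 ≤ 40960 * (E ^ 5 * M * (x / S) * y ^ 4) := by
    calc 10 * (U * B) * A ^ 3 ≤ 10 * (512 * (x / (M ^ 3 * S))) * (2 * M) ^ 3 := by gcongr
      _ = 40960 * (1 * M * (x / S) * (1 / M)) := by field_simp; ring
      _ ≤ _ := by gcongr; exact one_le_pow₀ hE
  have a3 : 16 * A * (E ^ 2 * Q) ≤ 1280000000 * (E ^ 5 * M * (x / S) * y ^ 4) := by
    calc 16 * A * (E ^ 2 * Q)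
        ≤ 16 * (2 * M) * (E ^ 2 * (40000000 * (E ^ 3 * (x / S) * y ^ 4))) := by gcongr
      _ = _ := by ring
  have a4 : 10 * (U * B) * A ^ 3 + 16 * A * (E ^ 2 * Q)
      ≤ 1300000000 * (E ^ 5 * M * (x / S) * y ^ 4) := by
    have : 0 ≤ E ^ 5 * M * (x / S) * y ^ 4 := by positivity
    linarith
  have a5 : T ^ 4 ≤ (21500 * (E ^ 2 * (x / (M ^ 2 * S)) * y)) ^ 4 := by
    calc T ^ 4 ≤ _ := hT
      _ ≤ (512 * (x / (M ^ 3 * S))) ^ 3 * (1300000000 * (E ^ 5 * M * (x / S) * y ^ 4)) := by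
        gcongr
      _ = (512 ^ 3 * 1300000000) * (E ^ 5 * ((x / (M ^ 2 * S)) ^ 4 * y ^ 4)) := by
        field_simp
      _ ≤ (21500 ^ 4) * (E ^ 8 * ((x / (M ^ 2 * S)) ^ 4 * y ^ 4)) := by
        gcongr
        · norm_num
        · norm_num
      _ = _ := by ring
  exact le_of_pow_le_pow_left₀ (by norm_num) (by positivity) a5

lemma ceil_le_two {X : ℝ} (h : 1 ≤ X) : (⌈X⌉₊ : ℝ) ≤ 2 * X := by
  have := Nat.ceil_lt_add_one (by linarith : 0 ≤ X)
  linarith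

lemma core {α x M S J E y : ℝ} {a : ℤ} {q N : ℕ} (hq : 1 ≤ q) (hg : Int.gcd a q = 1)
    (hα : |α - (a : ℝ) / q| < 1 / (q : ℝ) ^ 2) (hM : 1 ≤ M) (hS : 1 ≤ S) (hJ : 1 ≤ J)
    (hx : M ^ 3 * S ^ 2 * J ≤ x) (hE1 : 1 ≤ E) (hE : DivB N E)
    (hlog : ∀ n : ℕ, n ≤ N → 1 + Real.log n ≤ E)
    (hN : ∀ n : ℕ, (n : ℝ) ≤ 100000 * x → n ≤ N) (hqx : q ≤ x) (hy : 0 ≤ y)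
    (y1 : 1 / M ≤ y ^ 4) (y2 : 1 / S ≤ y ^ 8) (y3 : 1 / (q : ℝ) ≤ y ^ 8) (y4 : q / x ≤ y ^ 8) :
    ∑ m ∈ dyad M, ∑ s ∈ dyad S, ∑ j ∈ dyad J,
      mn ⌈64 * (x / (M ^ 3 * S ^ 2 * J))⌉₊ (α * ((m : ℝ) ^ 3 * (s : ℝ) ^ 2 * (j : ℝ))) ≤
      3000000 * E ^ 4 * (M * S * J + x / (M ^ 2 * S) * y) := by
  have hM0 : 0 < M := by linarith
  have hS0 : 0 < S := by linarith
  have hJ0 : 0 < J := by linarith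
  have hq' : (1 : ℝ) ≤ q := by exact_mod_cast hq
  have hx0 : 0 < x := lt_of_lt_of_le (by positivity) hx
  have hH0 : 1 ≤ x / (M ^ 3 * S ^ 2 * J) := by rw [le_div_iff₀ (by positivity)]; linarith
  have hM3 : 1 ≤ M ^ 3 := one_le_pow₀ hM
  have hS2 : 1 ≤ S ^ 2 := one_le_pow₀ hS
  have hSx : S ^ 2 ≤ x := by
    refine le_trans ?_ hx
    calc S ^ 2 = 1 * S ^ 2 * 1 := by ring
      _ ≤ _ := by gcongr
  have hMx : M ≤ x := by
    refine le_trans ?_ hx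
    calc M = M ^ 1 * 1 * 1 := by ring
      _ ≤ _ := by gcongr; norm_num
  have hdiv : ∀ t : ℝ, 1 ≤ t → x / t ≤ x := fun t ht => div_le_self hx0.le ht
  unfold dyad
  set H := ⌈64 * (x / (M ^ 3 * S ^ 2 * J))⌉₊ with hHdef
  set A := ⌈M⌉₊ with hAdef
  set B := ⌈S⌉₊ with hBdef
  set Jn := ⌈J⌉₊ with hJdef
  have hA : (A : ℝ) ≤ 2 * M := ceil_le_two hM
  have hB : (B : ℝ) ≤ 2 * S := ceil_le_two hS
  have hJn : (Jn : ℝ) ≤ 2 * J := ceil_le_two hJ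
  have hH : (H : ℝ) ≤ 2 * (64 * (x / (M ^ 3 * S ^ 2 * J))) := ceil_le_two (by linarith)
  have hA1 : 1 ≤ A := Nat.one_le_ceil_iff.2 hM0
  have hH1 : 1 ≤ H := Nat.one_le_ceil_iff.2 (by positivity)
  have hJ1 : 1 ≤ Jn := Nat.one_le_ceil_iff.2 hJ0
  have hU : ((H * Jn : ℕ) : ℝ) ≤ 256 * (x / (M ^ 3 * S ^ 2)) := by
    push_cast
    calc (H : ℝ) * Jn ≤ (2 * (64 * (x / (M ^ 3 * S ^ 2 * J)))) * (2 * J) := by gcongr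
      _ = _ := by field_simp; ring
  have hUx : ((H * Jn : ℕ) : ℝ) ≤ 256 * x := hU.trans (by
    gcongr; exact hdiv _ (by nlinarith))
  have hHx : (H : ℝ) ≤ 256 * x := le_trans (by
    exact_mod_cast Nat.le_mul_of_pos_right H hJ1) hUx
  set U := H * Jn with hUdef
  have hW : ((6 * (U * A * A) : ℕ) : ℝ) ≤ 6144 * (x / (M * S ^ 2)) := by
    push_cast
    calc 6 * ((U : ℝ) * A * A) ≤ 6 * ((256 * (x / (M ^ 3 * S ^ 2))) * (2 * M) * (2 * M)) := by
          gcongr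
      _ = _ := by field_simp; ring
  have hWx : ((6 * (U * A * A) : ℕ) : ℝ) ≤ 6144 * x := hW.trans (by
    gcongr; exact hdiv _ (by nlinarith))
  set W := 6 * (U * A * A) with hWdef
  have hV : ((A * W : ℕ) : ℝ) ≤ 12288 * (x / S ^ 2) := by
    push_cast
    calc (A : ℝ) * W ≤ (2 * M) * (6144 * (x / (M * S ^ 2))) := by gcongr
      _ = _ := by field_simp; ring
  have hVx : ((A * W : ℕ) : ℝ) ≤ 12288 * x := hV.trans (by
    gcongr; exact hdiv _ (by nlinarith))
  set V := A * W with hVdef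
  have hY : ((2 * (B * V) : ℕ) : ℝ) ≤ 49152 * (x / S) := by
    push_cast
    calc 2 * ((B : ℝ) * V) ≤ 2 * ((2 * S) * (12288 * (x / S ^ 2))) := by gcongr
      _ = _ := by field_simp; ring
  have hYx : ((2 * (B * V) : ℕ) : ℝ) ≤ 49152 * x := hY.trans (by
    gcongr; exact hdiv _ hS)
  have dY : DivB (2 * (B * V)) E := hE.mono (hN _ (by linarith))
  have dV : DivB V E := hE.mono (hN _ (by linarith))
  have dW : DivB W E := hE.mono (hN _ (by linarith))
  have dU : DivB U E := hE.mono (hN _ (by linarith))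
  have lA : 1 + Real.log A ≤ E := hlog _ (hN _ (by linarith))
  have lH : 1 + Real.log H ≤ E := hlog _ (hN _ (by linarith))
  have lq : 1 + Real.log q ≤ E := hlog _ (hN _ (by linarith))
  have l0 : ∀ n : ℕ, 0 ≤ 1 + Real.log n := fun n => by
    have := Real.log_natCast_nonneg n; linarith
  have sZ := count hq hg hα (Nat.cast_nonneg B : (0 : ℝ) ≤ B) (2 * (B * V))
  have nZ := sZ.trans (Z_num hS hq' hE1 hSx (by positivity) y2 y3 y4 hY (by positivity) hB (l0 q)
    lq (by positivity))
  have sR := R_step α V B ⌈S / 2⌉₊ B le_rfl E dY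
  have nR := R_num hS hE1 hx0 hy y2 (by positivity) hV (by positivity) hB nZ sR
  have sQ := Q_step α W A B ⌈S / 2⌉₊ B hA1 le_rfl E dV
  have nQ := Q_num hM hS hE1 hx0 hy y1 (by positivity) hW (by positivity) hB
    (Finset.sum_nonneg fun i _ => norm_nonneg _) nR (l0 A) lA sQ
  have sT := T_step α U A B ⌈S / 2⌉₊ B ⌈M / 2⌉₊ A hA1 le_rfl le_rfl E hE1 dW
  have nT := T_num hM hS hE1 hx0 hy y1 (by positivity) hU (by positivity) hB (by positivity) hA
    (Finset.sum_nonneg fun i _ => Finset.sum_nonneg fun j _ => mn_nonneg (by positivity) _) nQ sT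
  have sG := G_step α H A B Jn ⌈S / 2⌉₊ B ⌈M / 2⌉₊ A ⌈J / 2⌉₊ Jn hH1 le_rfl le_rfl
    (Nat.one_le_ceil_iff.2 (by positivity)) le_rfl E dU
  refine sG.trans ?_
  have hABJ : (A : ℝ) * B * Jn ≤ 8 * (M * S * J) := by
    calc (A : ℝ) * B * Jn ≤ (2 * M) * (2 * S) * (2 * J) := by gcongr
      _ = _ := by ring
  have hE3 : 1 ≤ E ^ 3 := one_le_pow₀ hE1
  set P := x / (M ^ 2 * S) * y with hP
  have hP0 : 0 ≤ P := by positivity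
  calc _ ≤ 128 * E * (8 * (M * S * J) + E * (21500 * (E ^ 2 * (x / (M ^ 2 * S)) * y))) := by
        gcongr
    _ = 1024 * E * (1 * (M * S * J)) + 2752000 * E ^ 4 * P := by rw [hP]; ring
    _ ≤ 1024 * E * (E ^ 3 * (M * S * J)) + 2752000 * E ^ 4 * P := by gcongr
    _ = 1024 * (E ^ 4 * (M * S * J)) + 2752000 * (E ^ 4 * P) := by ring
    _ ≤ 3000000 * (E ^ 4 * (M * S * J)) + 3000000 * (E ^ 4 * P) := by gcongr <;> norm_num
    _ = _ := by ring


lemma dyad_empty {X : ℝ} (h0 : 0 < X) (h : X ≤ 1) : dyad X = ∅ := by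
  unfold dyad
  rw [Finset.Ico_eq_empty_iff, not_lt]
  have h1 : 1 ≤ ⌈X / 2⌉₊ := Nat.one_le_ceil_iff.2 (by positivity)
  have h2 : ⌈X⌉₊ ≤ 1 := Nat.ceil_le.2 (by simpa using h)
  omega

lemma mem_dyad {X : ℝ} (h0 : 0 < X) {n : ℕ} (h : n ∈ dyad X) :
    1 ≤ n ∧ X / 2 ≤ n ∧ (n : ℝ) < X := by
  unfold dyad at h
  rw [Finset.mem_Ico] at h
  refine ⟨(Nat.one_le_ceil_iff.2 (by positivity)).trans h.1, ?_, Nat.lt_ceil.1 h.2⟩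
  exact Nat.ceil_le.1 h.1

lemma card_dyad_le {X : ℝ} (h : 1 ≤ X) : ((dyad X).card : ℝ) ≤ 2 * X := by
  refine le_trans ?_ (ceil_le_two h)
  unfold dyad
  rw [Nat.card_Ico]
  exact_mod_cast Nat.sub_le _ _

lemma trivial_bound {α x M S J : ℝ} (hM : 1 ≤ M) (hS : 1 ≤ S) (hJ : 1 ≤ J)
    (hx : M ^ 3 * S ^ 2 * J ≤ x) :
    ∑ m ∈ dyad M, ∑ s ∈ dyad S, ∑ j ∈ dyad J,
      mn ⌈64 * (x / (M ^ 3 * S ^ 2 * J))⌉₊ (α * ((m : ℝ) ^ 3 * (s : ℝ) ^ 2 * (j : ℝ))) ≤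
      1024 * (x / (M ^ 2 * S)) := by
  have hM0 : 0 < M := by linarith
  have hS0 : 0 < S := by linarith
  have hJ0 : 0 < J := by linarith
  have hx0 : 0 < x := lt_of_lt_of_le (by positivity) hx
  have hH0 : 1 ≤ x / (M ^ 3 * S ^ 2 * J) := by rw [le_div_iff₀ (by positivity)]; linarith
  set H := ⌈64 * (x / (M ^ 3 * S ^ 2 * J))⌉₊ with hHdef
  have hH : (H : ℝ) ≤ 2 * (64 * (x / (M ^ 3 * S ^ 2 * J))) := ceil_le_two (by linarith)
  calc _ ≤ ∑ m ∈ dyad M, ∑ s ∈ dyad S, ∑ j ∈ dyad J, (H : ℝ) :=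
        Finset.sum_le_sum fun m _ => Finset.sum_le_sum fun s _ => Finset.sum_le_sum fun j _ =>
          mn_le (by positivity) _
    _ = (dyad M).card * ((dyad S).card * ((dyad J).card * (H : ℝ))) := by
        simp
    _ ≤ (2 * M) * ((2 * S) * ((2 * J) * (2 * (64 * (x / (M ^ 3 * S ^ 2 * J)))))) := by
        gcongr
        · exact card_dyad_le hM
        · exact card_dyad_le hS
        · exact card_dyad_le hJ
    _ = _ := by field_simp; ring

lemma G_le_mn {α x M S J E : ℝ} {μ σ ζ N : ℕ} (hM : 1 ≤ M) (hS : 1 ≤ S) (hJ : 1 ≤ J)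
    (hx : M ^ 3 * S ^ 2 * J ≤ x) (hE1 : 1 ≤ E) (hE : DivB N E)
    (hN : ∀ n : ℕ, (n : ℝ) ≤ x → n ≤ N) :
    Gsum α x M S J μ σ ζ ≤ E ^ (μ + σ + ζ) * ∑ m ∈ dyad M, ∑ s ∈ dyad S, ∑ j ∈ dyad J,
      mn ⌈64 * (x / (M ^ 3 * S ^ 2 * J))⌉₊ (α * ((m : ℝ) ^ 3 * (s : ℝ) ^ 2 * (j : ℝ))) := by
  have hM0 : 0 < M := by linarith
  have hS0 : 0 < S := by linarith
  have hJ0 : 0 < J := by linarith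
  have hx0 : 0 < x := lt_of_lt_of_le (by positivity) hx
  have hM3 : M ≤ M ^ 3 := le_self_pow₀ hM (by norm_num)
  have hS2 : S ≤ S ^ 2 := le_self_pow₀ hS (by norm_num)
  have hMx : M ≤ x := by
    refine le_trans ?_ hx
    calc M = M * 1 * 1 := by ring
      _ ≤ _ := by gcongr; linarith
  have hSx : S ≤ x := by
    refine le_trans ?_ hx
    calc S = 1 * S * 1 := by ring
      _ ≤ _ := by gcongr; linarith
  have hJx : J ≤ x := by
    refine le_trans ?_ hx
    calc J = 1 * 1 * J := by ring
      _ ≤ _ := by gcongr <;> linarith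
  have htau : ∀ k n : ℕ, 1 ≤ n → (n : ℝ) ≤ x → (tauk k n : ℝ) ≤ E ^ k := by
    intro k n h1 h2
    calc (tauk k n : ℝ) ≤ (n.divisors.card : ℝ) ^ k := by exact_mod_cast tauk_le k n h1
      _ ≤ E ^ k := by gcongr; exact hE n h1 (hN n h2)
  unfold Gsum
  have hR : E ^ (μ + σ + ζ) * ∑ m ∈ dyad M, ∑ s ∈ dyad S, ∑ j ∈ dyad J,
      mn ⌈64 * (x / (M ^ 3 * S ^ 2 * J))⌉₊ (α * ((m : ℝ) ^ 3 * (s : ℝ) ^ 2 * (j : ℝ)))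
      = ∑ m ∈ dyad M, E ^ μ * ∑ s ∈ dyad S, E ^ σ * ∑ j ∈ dyad J, E ^ ζ *
      mn ⌈64 * (x / (M ^ 3 * S ^ 2 * J))⌉₊ (α * ((m : ℝ) ^ 3 * (s : ℝ) ^ 2 * (j : ℝ))) := by
    simp_rw [← Finset.mul_sum]
    rw [pow_add, pow_add]; ring
  rw [hR]
  refine Finset.sum_le_sum fun m hm => ?_
  obtain ⟨m1, m2, m3⟩ := mem_dyad hM0 hm
  have hmin : ∀ s j : ℕ, 0 ≤ min (x / ((m : ℝ) ^ 3 * (s : ℝ) ^ 2 * (j : ℝ)))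
          (1 / nint (α * ((m : ℝ) ^ 3 * (s : ℝ) ^ 2 * (j : ℝ)))) := fun s j => by
    have := nint_nonneg (α * ((m : ℝ) ^ 3 * (s : ℝ) ^ 2 * (j : ℝ)))
    exact le_min (by positivity) (by positivity)
  refine mul_le_mul (htau μ m m1 (by linarith)) ?_ (Finset.sum_nonneg fun s _ =>
    mul_nonneg (Nat.cast_nonneg _) (Finset.sum_nonneg fun j _ => mul_nonneg (Nat.cast_nonneg _)
      (hmin s j))) (by positivity)
  refine Finset.sum_le_sum fun s hs => ?_
  obtain ⟨s1, s2, s3⟩ := mem_dyad hS0 hs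
  refine mul_le_mul (htau σ s s1 (by linarith)) ?_ (Finset.sum_nonneg fun j _ =>
    mul_nonneg (Nat.cast_nonneg _) (hmin s j)) (by positivity)
  refine Finset.sum_le_sum fun j hj => ?_
  obtain ⟨j1, j2, j3⟩ := mem_dyad hJ0 hj
  refine mul_le_mul (htau ζ j j1 (by linarith)) ?_ (hmin s j) (by positivity)
  refine min_le_mn (by positivity) ?_ _
  refine le_trans ?_ (Nat.le_ceil _)
  calc x / ((m : ℝ) ^ 3 * (s : ℝ) ^ 2 * (j : ℝ)) ≤ x / ((M / 2) ^ 3 * (S / 2) ^ 2 * (J / 2)) := by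
        gcongr
    _ = _ := by field_simp; norm_num

lemma rpow_facts {t : ℝ} (ht : 0 < t) : (t ^ ((1 : ℝ) / 8)) ^ 8 = t := by
  rw [← Real.rpow_natCast, ← Real.rpow_mul ht.le]; norm_num

set_option maxHeartbeats 2000000 in
/-- Inequality (9) of Lemma 7. -/
theorem statement_4 (μ σ ζ : ℕ) (hμ : 2 ≤ μ) (hσ : 2 ≤ σ) (hζ : 2 ≤ ζ)
    (ε : ℝ) (hε : 0 < ε) :
    ∃ C : ℝ, ∀ (α : ℝ) (a : ℤ) (q : ℕ) (M S J x : ℝ),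
      Irrational α → 1 ≤ q → Int.gcd a q = 1 →
      |α - (a : ℝ) / q| < 1 / (q : ℝ) ^ 2 →
      0 < M → 0 < S → 0 < J → M ^ 3 * S ^ 2 * J < x →
      Gsum α x M S J μ σ ζ ≤
        C * x ^ ε * (M * S * J + x / (M ^ ((9 : ℝ) / 4) * S)
          + x / (M ^ 2 * S ^ ((9 : ℝ) / 8))
          + x / (M ^ 2 * S * (q : ℝ) ^ ((1 : ℝ) / 8))
          + x ^ ((7 : ℝ) / 8) * (q : ℝ) ^ ((1 : ℝ) / 8) / (M ^ 2 * S)) := by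
  set p := μ + σ + ζ with hp
  set δ : ℝ := ε / (p + 4 : ℕ) with hδdef
  have hp4 : (0 : ℝ) < (p + 4 : ℕ) := by positivity
  have hδ : 0 < δ := by positivity
  obtain ⟨C₁, hC₁, hdiv⟩ := divisor_bound δ hδ
  set K : ℝ := (C₁ + 1 + 1 / δ) * (100000 : ℝ) ^ δ with hK
  have hK0 : 0 < K := by positivity
  refine ⟨3000000 * K ^ (p + 4), ?_⟩
  intro α a q M S J x _ hq hg hα hM0 hS0 hJ0 hx
  have hx0 : 0 < x := lt_trans (by positivity) hx
  have hq0 : (0 : ℝ) < q := by exact_mod_cast hq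
  by_cases hne : 1 < M ∧ 1 < S ∧ 1 < J
  swap
  · have hG : Gsum α x M S J μ σ ζ = 0 := by
      unfold Gsum
      by_cases h1 : 1 < M
      · by_cases h2 : 1 < S
        · have h3 : J ≤ 1 := not_lt.1 fun h => hne ⟨h1, h2, h⟩
          simp [dyad_empty hJ0 h3]
        · simp [dyad_empty hS0 (not_lt.1 h2)]
      · simp [dyad_empty hM0 (not_lt.1 h1)]
    rw [hG]; positivity
  obtain ⟨hM, hS, hJ⟩ := hne
  have hx1 : 1 ≤ x := by
    refine le_trans ?_ hx.le
    calc (1 : ℝ) = 1 ^ 3 * 1 ^ 2 * 1 := by norm_num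
      _ ≤ _ := by gcongr
  set E : ℝ := K * x ^ δ with hEdef
  have hxδ : 1 ≤ x ^ δ := Real.one_le_rpow hx1 hδ.le
  have h5 : (1 : ℝ) ≤ (100000 : ℝ) ^ δ := Real.one_le_rpow (by norm_num) hδ.le
  have hEeq : E = (C₁ + 1 + 1 / δ) * (100000 * x) ^ δ := by
    rw [hEdef, hK, Real.mul_rpow (by norm_num) hx0.le, mul_assoc]
  have hbig : (1 : ℝ) ≤ (100000 * x) ^ δ := Real.one_le_rpow (by linarith) hδ.le
  have hδ' : 0 < 1 / δ := by positivity
  have hE1 : 1 ≤ E := by rw [hEeq]; nlinarith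
  set N := ⌊100000 * x⌋₊ with hNdef
  have hN : ∀ n : ℕ, (n : ℝ) ≤ 100000 * x → n ≤ N := fun n h => Nat.le_floor h
  have hN' : ∀ n : ℕ, n ≤ N → (n : ℝ) ≤ 100000 * x := fun n h =>
    (Nat.le_floor_iff (by positivity)).1 h
  have hE : DivB N E := by
    intro n h1 h2
    calc (n.divisors.card : ℝ) ≤ C₁ * (n : ℝ) ^ δ := hdiv n h1
      _ ≤ C₁ * (100000 * x) ^ δ := by gcongr; exact hN' n h2
      _ ≤ E := by rw [hEeq]; gcongr; linarith
  have hlog : ∀ n : ℕ, n ≤ N → 1 + Real.log n ≤ E := by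
    intro n h
    have h1 : Real.log n ≤ (n : ℝ) ^ δ / δ := Real.log_le_rpow_div (by positivity) hδ
    have h2 : (n : ℝ) ^ δ / δ ≤ (100000 * x) ^ δ / δ := by gcongr; exact hN' n h
    have h3 : (100000 * x) ^ δ / δ = 1 / δ * (100000 * x) ^ δ := by ring
    rw [hEeq]; nlinarith
  have hEp : E ^ (p + 4) = K ^ (p + 4) * x ^ ε := by
    rw [hEdef, mul_pow, ← Real.rpow_natCast (x ^ δ), ← Real.rpow_mul hx0.le, hδdef,
      div_mul_cancel₀ _ hp4.ne']
  -- the auxiliary roots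
  set u := M ^ ((1 : ℝ) / 4) with hu
  set v := S ^ ((1 : ℝ) / 8) with hv
  set w := (q : ℝ) ^ ((1 : ℝ) / 8) with hw
  set r := x ^ ((1 : ℝ) / 8) with hr
  have u0 : 0 < u := by positivity
  have v0 : 0 < v := by positivity
  have w0 : 0 < w := by positivity
  have r0 : 0 < r := by positivity
  have u4 : u ^ 4 = M := by
    rw [hu, ← Real.rpow_natCast, ← Real.rpow_mul hM0.le]; norm_num
  have v8 : v ^ 8 = S := rpow_facts hS0
  have w8 : w ^ 8 = q := rpow_facts hq0
  have r8 : r ^ 8 = x := rpow_facts hx0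
  have eM : M ^ ((9 : ℝ) / 4) = M ^ 2 * u := by
    rw [hu, ← Real.rpow_natCast, ← Real.rpow_add hM0]; norm_num
  have eS : S ^ ((9 : ℝ) / 8) = S * v := by
    rw [hv, ← Real.rpow_one_add' hS0.le (by norm_num)]; norm_num
  have ex : x ^ ((7 : ℝ) / 8) = x / r := by
    rw [hr, eq_div_iff r0.ne', hr, ← Real.rpow_add hx0]; norm_num
  rw [eM, eS, ex]
  set y := 1 / u + 1 / v + 1 / w + w / r with hy
  have i1 : 0 < 1 / u := by positivity
  have i2 : 0 < 1 / v := by positivity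
  have i3 : 0 < 1 / w := by positivity
  have i4 : 0 < w / r := by positivity
  have hy0 : 0 ≤ y := by positivity
  have y1 : 1 / M ≤ y ^ 4 := by
    calc 1 / M = (1 / u) ^ 4 := by rw [div_pow, u4, one_pow]
      _ ≤ _ := by gcongr; linarith
  have y2 : 1 / S ≤ y ^ 8 := by
    calc 1 / S = (1 / v) ^ 8 := by rw [div_pow, v8, one_pow]
      _ ≤ _ := by gcongr; linarith
  have y3 : 1 / (q : ℝ) ≤ y ^ 8 := by
    calc 1 / (q : ℝ) = (1 / w) ^ 8 := by rw [div_pow, w8, one_pow]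
      _ ≤ _ := by gcongr; linarith
  have y4 : q / x ≤ y ^ 8 := by
    calc q / x = (w / r) ^ 8 := by rw [div_pow, w8, r8]
      _ ≤ _ := by gcongr; linarith
  have hrhs : M * S * J + x / (M ^ 2 * u * S) + x / (M ^ 2 * (S * v)) + x / (M ^ 2 * S * w)
      + x / r * w / (M ^ 2 * S) = M * S * J + x / (M ^ 2 * S) * y := by
    rw [hy]; field_simp; ring
  rw [hrhs, mul_assoc 3000000, ← hEp]
  have hGm := G_le_mn (α := α) (μ := μ) (σ := σ) (ζ := ζ) hM.le hS.le hJ.le hx.le hE1 hE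
    (fun n h => hN n (by linarith))
  refine hGm.trans ?_
  have hsum : ∑ m ∈ dyad M, ∑ s ∈ dyad S, ∑ j ∈ dyad J,
      mn ⌈64 * (x / (M ^ 3 * S ^ 2 * J))⌉₊ (α * ((m : ℝ) ^ 3 * (s : ℝ) ^ 2 * (j : ℝ))) ≤
      3000000 * E ^ 4 * (M * S * J + x / (M ^ 2 * S) * y) := by
    by_cases hqx : (q : ℝ) ≤ x
    · exact core hq hg hα hM.le hS.le hJ.le hx.le hE1 hE hlog hN hqx hy0 y1 y2 y3 y4
    · refine (trivial_bound hM.le hS.le hJ.le hx.le).trans ?_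
      have hqx1 : 1 ≤ q / x := by rw [le_div_iff₀ hx0]; linarith [not_le.1 hqx]
      have hy1 : 1 ≤ y := by
        have : (1 : ℝ) ≤ y ^ 8 := hqx1.trans y4
        by_contra h
        have := pow_lt_one₀ hy0 (not_le.1 h) (by norm_num : 8 ≠ 0)
        linarith
      have hE4 : 1 ≤ E ^ 4 := one_le_pow₀ hE1
      have hMSJ : 0 ≤ M * S * J := by positivity
      have hP : 0 ≤ x / (M ^ 2 * S) := by positivity
      have h1 : x / (M ^ 2 * S) ≤ M * S * J + x / (M ^ 2 * S) * y := by
        have := le_mul_of_one_le_right hP hy1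
        linarith
      calc 1024 * (x / (M ^ 2 * S)) ≤ 3000000 * 1 * (x / (M ^ 2 * S)) := by linarith
        _ ≤ _ := by gcongr
  calc _ ≤ E ^ (μ + σ + ζ) * (3000000 * E ^ 4 * (M * S * J + x / (M ^ 2 * S) * y)) :=
        mul_le_mul_of_nonneg_left hsum (by positivity)
    _ = _ := by rw [pow_add E p 4]; ring
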